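/- arXiv:2006.00893 — 5 statements merged into one kernel-verified Lean document; each statement's English description precedes it below -/
import Mathlib

section
/- Let 𝓑 be an unbounded bornology on an infinite set I. The 𝓑-macrocube is normal if and only if 𝓑 has a linearly ordered base. -/
open scoped symmDiff

/-- A bornology on a set (type) `ι`: a family of subsets containing all finite
subsets, closed under taking subsets and finite unions. -/
def IsBornology {ι : Type*} (𝓑 : Set (Set ι)) : Prop :=
  (∀ A : Set ι, A.Finite → A ∈ 𝓑) ∧
  (∀ A B : Set ι, A ∈ 𝓑 → B ⊆ A → B ∈ 𝓑) ∧
  (∀ A B : Set ι, A ∈ 𝓑 → B ∈ 𝓑 → A ∪ B ∈ 𝓑)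

/-- `E_B[Y]` in the `𝓑`-macrocube: the points of the macrocube (members of `𝓑`)
that are `B`-close to some member of `Y`. -/
def mcE {ι : Type*} (𝓑 : Set (Set ι)) (B : Set ι) (Y : Set (Set ι)) : Set (Set ι) :=
  {A | A ∈ 𝓑 ∧ ∃ A' ∈ Y, A ∆ A' ⊆ B}

/-- A subset of the `𝓑`-macrocube is bounded if all pairwise symmetric
differences are contained in a single member of `𝓑`. -/
def mcBounded {ι : Type*} (𝓑 : Set (Set ι)) (Y : Set (Set ι)) : Prop :=
  ∃ B ∈ 𝓑, ∀ A ∈ Y, ∀ A' ∈ Y, A ∆ A' ⊆ B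

/-- Asymptotic disjointness in the `𝓑`-macrocube. -/
def mcAsympDisjoint {ι : Type*} (𝓑 : Set (Set ι)) (Y Z : Set (Set ι)) : Prop :=
  ∀ B ∈ 𝓑, mcBounded 𝓑 (mcE 𝓑 B Y ∩ mcE 𝓑 B Z)

/-- `U` is an asymptotic neighbourhood of `Y` in the `𝓑`-macrocube. -/
def mcAsympNbhd {ι : Type*} (𝓑 : Set (Set ι)) (Y U : Set (Set ι)) : Prop :=
  ∀ B ∈ 𝓑, mcBounded 𝓑 (mcE 𝓑 B Y \ U)

/-- The `𝓑`-macrocube is normal: any two asymptotically disjoint subsets have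
disjoint asymptotic neighbourhoods. -/
def mcNormal {ι : Type*} (𝓑 : Set (Set ι)) : Prop :=
  ∀ Y Z : Set (Set ι), Y ⊆ 𝓑 → Z ⊆ 𝓑 → mcAsympDisjoint 𝓑 Y Z →
    ∃ U V : Set (Set ι), mcAsympNbhd 𝓑 Y U ∧ mcAsympNbhd 𝓑 Z V ∧ Disjoint U V

/-- `𝓑` has a linearly ordered base. -/
def HasLinearBase {ι : Type*} (𝓑 : Set (Set ι)) : Prop :=
  ∃ 𝓒 ⊆ 𝓑, IsChain (· ⊆ ·) 𝓒 ∧ ∀ B ∈ 𝓑, ∃ C ∈ 𝓒, B ⊆ C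

/-- A bounded set of points of the macrocube has its union in the bornology. -/
lemma mcBounded.exists_superset {ι : Type*} {𝓑 : Set (Set ι)} (hB : IsBornology 𝓑)
    {Y : Set (Set ι)} (hY : Y ⊆ 𝓑) (h : mcBounded 𝓑 Y) : ∃ B ∈ 𝓑, ∀ A ∈ Y, A ⊆ B := by
  obtain ⟨B, hBB, hdiff⟩ := h
  rcases Y.eq_empty_or_nonempty with rfl | ⟨A₀, hA₀⟩
  · exact ⟨B, hBB, by simp⟩
  · refine ⟨B ∪ A₀, hB.2.2 _ _ hBB (hY hA₀), fun A hA x hx => ?_⟩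
    by_cases hx₀ : x ∈ A₀
    · exact Or.inr hx₀
    · exact Or.inl (hdiff A hA A₀ hA₀ (Or.inl ⟨hx, hx₀⟩))

/-- A family of points whose members all lie in one member of the bornology is bounded. -/
lemma mcBounded_of_forall_subset {ι : Type*} {𝓑 Y : Set (Set ι)} {B : Set ι} (hB : B ∈ 𝓑)
    (h : ∀ A ∈ Y, A ⊆ B) : mcBounded 𝓑 Y :=
  ⟨B, hB, fun A hA A' hA' => symmDiff_le_sup.trans (sup_le (h A hA) (h A' hA'))⟩

lemma mcBounded.mono {ι : Type*} {𝓑 Y Z : Set (Set ι)} (h : mcBounded 𝓑 Z) (hYZ : Y ⊆ Z) :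
    mcBounded 𝓑 Y :=
  let ⟨B, hB, hd⟩ := h
  ⟨B, hB, fun A hA A' hA' => hd A (hYZ hA) A' (hYZ hA')⟩

lemma mcE_mono {ι : Type*} {𝓑 : Set (Set ι)} {B C : Set ι} (h : B ⊆ C) (Y : Set (Set ι)) :
    mcE 𝓑 B Y ⊆ mcE 𝓑 C Y :=
  fun _ ⟨hA, A', hA', hd⟩ => ⟨hA, A', hA', hd.trans h⟩

/-- A macrocube over a bornology with a linearly ordered base is normal. -/
lemma HasLinearBase.mcNormal {ι : Type*} {𝓑 : Set (Set ι)} (h : HasLinearBase 𝓑) :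
    mcNormal 𝓑 := by
  obtain ⟨𝓒, h𝓒, hchain, hcof⟩ := h
  intro Y Z _ _ hdisj
  refine ⟨{A | ∃ C ∈ 𝓒, A ∈ mcE 𝓑 C Y ∧ A ∉ mcE 𝓑 C Z},
    {A | ∃ C ∈ 𝓒, A ∈ mcE 𝓑 C Z ∧ A ∉ mcE 𝓑 C Y}, ?_, ?_, ?_⟩
  · intro B hB
    obtain ⟨C, hC, hBC⟩ := hcof B hB
    refine (hdisj C (h𝓒 hC)).mono fun A ⟨hA, hU⟩ => ⟨mcE_mono hBC Y hA, ?_⟩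
    by_contra hZ
    exact hU ⟨C, hC, mcE_mono hBC Y hA, hZ⟩
  · intro B hB
    obtain ⟨C, hC, hBC⟩ := hcof B hB
    refine (hdisj C (h𝓒 hC)).mono fun A ⟨hA, hV⟩ => ⟨?_, mcE_mono hBC Z hA⟩
    by_contra hY
    exact hV ⟨C, hC, mcE_mono hBC Z hA, hY⟩
  · rw [Set.disjoint_left]
    rintro A ⟨C, hC, hCY, hCZ⟩ ⟨C', hC', hCZ', hCY'⟩
    rcases hchain.total hC hC' with hle | hle
    · exact hCY' (mcE_mono hle Y hCY)
    · exact hCZ (mcE_mono hle Z hCZ')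

/-- An unbounded bornology contains a chain whose union is not in it. -/
lemma IsBornology.exists_chain_sUnion_notMem {ι : Type*} {𝓑 : Set (Set ι)} (hB : IsBornology 𝓑)
    (hunb : Set.univ ∉ 𝓑) : ∃ Z ⊆ 𝓑, IsChain (· ⊆ ·) Z ∧ ⋃₀ Z ∉ 𝓑 := by
  by_contra! hcon
  obtain ⟨M, hM⟩ := zorn_subset 𝓑 fun c hc hchain =>
    ⟨⋃₀ c, hcon c hc hchain, fun _ => Set.subset_sUnion_of_mem⟩
  refine hunb ((Set.eq_univ_of_forall fun i => ?_) ▸ hM.prop)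
  have hmem : M ∪ {i} ∈ 𝓑 := hB.2.2 _ _ hM.prop (hB.1 _ (Set.finite_singleton i))
  exact hM.le_of_ge hmem Set.subset_union_left (Or.inr rfl)

/-- Singletons are asymptotically disjoint from any chain whose union is not in the bornology. -/
lemma mcAsympDisjoint_singletons_of_isChain {ι : Type*} {𝓑 : Set (Set ι)} (hB : IsBornology 𝓑)
    {Z : Set (Set ι)} (hZ : Z ⊆ 𝓑) (hchain : IsChain (· ⊆ ·) Z) (hunion : ⋃₀ Z ∉ 𝓑) :
    mcAsympDisjoint 𝓑 (Set.range fun i : ι => ({i} : Set ι)) Z := by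
  intro B hBB
  have exists_notMem : ∀ C ∈ 𝓑, ∃ x ∉ C, ∃ z ∈ Z, x ∈ z := by
    intro C hC
    by_contra! h
    refine hunion (hB.2.1 C _ hC fun x ⟨z, hz, hxz⟩ => ?_)
    by_contra hx
    exact h x hx z hz hxz
  obtain ⟨x, hx, z₁, hz₁, hxz₁⟩ := exists_notMem B hBB
  obtain ⟨y, hy, z₂, hz₂, hyz₂⟩ :=
    exists_notMem (B ∪ {x}) (hB.2.2 _ _ hBB (hB.1 _ (Set.finite_singleton x)))
  refine mcBounded_of_forall_subset
    (hB.2.2 _ _ (hB.2.2 _ _ (hZ hz₁) (hZ hz₂)) hBB) (B := z₁ ∪ z₂ ∪ B) ?_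
  rintro A ⟨⟨-, _, ⟨i, rfl⟩, hAi⟩, ⟨-, z, hz, hAz⟩⟩
  have hzi : ∀ w ∈ z, w ∉ B → w = i := by
    intro w hw hwB
    by_contra hwi
    by_cases hwA : w ∈ A
    · exact hwB (hAi (Or.inl ⟨hwA, hwi⟩))
    · exact hwB (hAz (Or.inr ⟨hw, hwA⟩))
  have hzz : z ⊆ z₁ ∪ z₂ := by
    rcases hchain.total hz hz₁ with h | h
    · exact h.trans Set.subset_union_left
    rcases hchain.total hz hz₂ with h' | h'
    · exact h'.trans Set.subset_union_right
    have hyx : y = x :=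
      (hzi y (h' hyz₂) fun h => hy (Or.inl h)).trans (hzi x (h hxz₁) hx).symm
    exact absurd (Or.inr hyx) hy
  intro w hw
  by_cases hwz : w ∈ z
  · exact Or.inl (hzz hwz)
  · exact Or.inr (hAz (Or.inl ⟨hw, hwz⟩))

/-- A normal macrocube over an unbounded bornology has a linearly ordered base: separate the
singletons from a chain `Z` with unbounded union by `U` and `V`, and take for `z ∈ Z` the set of
`i` such that `{i} ∆ z' ∉ U` for some `z' ∈ Z` below `z`. -/
lemma mcNormal.hasLinearBase {ι : Type*} {𝓑 : Set (Set ι)} (hn : mcNormal 𝓑)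
    (hB : IsBornology 𝓑) (hunb : Set.univ ∉ 𝓑) : HasLinearBase 𝓑 := by
  obtain ⟨Z, hZ, hchain, hunion⟩ := hB.exists_chain_sUnion_notMem hunb
  have hsing (i : ι) : {i} ∈ 𝓑 := hB.1 _ (Set.finite_singleton i)
  have hmem (i : ι) {z : Set ι} (hz : z ∈ Z) : {i} ∆ z ∈ 𝓑 :=
    hB.2.1 _ _ (hB.2.2 _ _ (hsing i) (hZ hz)) symmDiff_le_sup
  obtain ⟨U, V, hU, hV, hUV⟩ := hn _ Z (by rintro _ ⟨i, rfl⟩; exact hsing i) hZ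
    (mcAsympDisjoint_singletons_of_isChain hB hZ hchain hunion)
  let h : Set ι → Set ι := fun z => {i | ∃ z' ∈ Z, z' ⊆ z ∧ {i} ∆ z' ∉ U}
  have h_mono : Monotone h := fun z w hzw i ⟨z', hz', hle, hi⟩ => ⟨z', hz', hle.trans hzw, hi⟩
  refine ⟨h '' Z, ?_, ?_, ?_⟩
  · rintro _ ⟨z, hz, rfl⟩
    obtain ⟨D, hD, hsub⟩ := (hU z (hZ hz)).exists_superset hB fun A hA => hA.1.1
    refine hB.2.1 _ _ (hB.2.2 _ _ hD (hZ hz)) fun i ⟨z', hz', hle, hi⟩ => ?_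
    by_cases hiz : i ∈ z'
    · exact Or.inr (hle hiz)
    · refine Or.inl (hsub ({i} ∆ z') ⟨⟨hmem i hz', {i}, ⟨i, rfl⟩, ?_⟩, hi⟩ (Or.inl ⟨rfl, hiz⟩))
      rwa [symmDiff_comm, symmDiff_symmDiff_cancel_left]
  · rintro _ ⟨z, hz, rfl⟩ _ ⟨w, hw, rfl⟩ -
    exact (hchain.total hz hw).imp (fun hle => h_mono hle) fun hle => h_mono hle
  · intro D hD
    obtain ⟨D', hD', hsub⟩ := (hV D hD).exists_superset hB fun A hA => hA.1.1
    obtain ⟨z, hz, hzD⟩ : ∃ z ∈ Z, ¬ z ⊆ D' ∪ D := by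
      by_contra! hcon
      exact hunion (hB.2.1 _ _ (hB.2.2 _ _ hD' hD) (Set.sUnion_subset hcon))
    refine ⟨h z, ⟨z, hz, rfl⟩, fun i hi => ⟨z, hz, subset_rfl, fun hiU => hzD fun w hw => ?_⟩⟩
    by_cases hwi : w = i
    · exact Or.inr (hwi ▸ hi)
    · refine Or.inl (hsub ({i} ∆ z)
        ⟨⟨hmem i hz, z, hz, ?_⟩, Set.disjoint_left.1 hUV hiU⟩ (Or.inr ⟨hw, hwi⟩))
      rw [symmDiff_symmDiff_cancel_right]
      exact Set.singleton_subset_iff.2 hi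

/-- **Theorem 4.1.** For an unbounded bornology `𝓑` on an infinite set `I`,
the `𝓑`-macrocube is normal iff `𝓑` has a linearly ordered base. -/
theorem macrocube_normal_iff_hasLinearBase {I : Type*} [Infinite I]
    (𝓑 : Set (Set I)) (hB : IsBornology 𝓑) (hunb : Set.univ ∉ 𝓑) :
    mcNormal 𝓑 ↔ HasLinearBase 𝓑 :=
  ⟨fun h => h.hasLinearBase hB hunb, HasLinearBase.mcNormal⟩
end

section
/- Let 𝓑 be an unbounded bornology on an infinite set κ such that the family {κ \ B : B ∈ 𝓑} is an ultrafilter on κ, and let n ≥ 1. Then the ballean {0,1}^𝓑_n, i.e., the subballean of the 𝓑-macrocube on X_n = {A ∈ 𝓑 : |A| ≤ n}, is ultranormal: any two unbounded subsets 𝒜₁, 𝒜₂ ⊆ X_n are linked. -/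
open scoped symmDiff

/-- The carrier `X_n = {A ∈ 𝓑 : |A| ≤ n}` of the ballean `{0,1}^𝓑_n`. -/
def mcXn {κ : Type*} (𝓑 : Set (Set κ)) (n : ℕ) : Set (Set κ) :=
  {A | A ∈ 𝓑 ∧ A.Finite ∧ A.ncard ≤ n}

/-- `E_B[Y]` inside the subballean on `X_n`. -/
def mcEn {κ : Type*} (𝓑 : Set (Set κ)) (n : ℕ) (B : Set κ) (Y : Set (Set κ)) :
    Set (Set κ) :=
  {A | A ∈ mcXn 𝓑 n ∧ ∃ A' ∈ Y, A ∆ A' ⊆ B}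

/-- `Y` and `Z` are linked in `{0,1}^𝓑_n`: some `E_B[Y] ∩ E_B[Z]` is unbounded. -/
def mcLinkedn {κ : Type*} (𝓑 : Set (Set κ)) (n : ℕ) (Y Z : Set (Set κ)) : Prop :=
  ∃ B ∈ 𝓑, ¬ mcBounded 𝓑 (mcEn 𝓑 n B Y ∩ mcEn 𝓑 n B Z)

/-- In every family of nonempty sets `f a`, `a ∈ t`, there is a disjoint subfamily that meets every
member of the family. -/
theorem exists_pairwiseDisjoint_subfamily_inter_nonempty {α ι : Type*} (f : ι → Set α) (t : Set ι)
    (hf : ∀ a ∈ t, (f a).Nonempty) :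
    ∃ u ⊆ t, u.PairwiseDisjoint f ∧ ∀ a ∈ t, ∃ b ∈ u, (f a ∩ f b).Nonempty := by
  obtain ⟨u, hut, hu, h⟩ := Vitali.exists_disjoint_subfamily_covering_enlargement f t
    (fun _ => 0) 2 one_lt_two (fun _ _ => le_rfl) 0 (fun _ _ => le_rfl) hf
  exact ⟨u, hut, hu, fun a ha => (h a ha).imp fun b hb => ⟨hb.1, hb.2.1⟩⟩

/-- If the complements of members of a bornology form an ultrafilter, then a family of sets of
bounded finite size (modulo a bounded set) with unbounded union traces singletons `{x}`, for
unboundedly many `x`, outside some bounded set. -/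
theorem IsBornology.exists_unbounded_singleton_traces {κ : Type*} [Nonempty κ]
    {𝓑 : Set (Set κ)} (hB : IsBornology 𝓑) (hultra : ∀ S : Set κ, S ∈ 𝓑 ∨ Sᶜ ∈ 𝓑) (k : ℕ) :
    ∀ (𝒜 : Set (Set κ)) (B : Set κ), B ∈ 𝓑 →
      (∀ A ∈ 𝒜, (A \ B).Finite ∧ (A \ B).ncard ≤ k) → ⋃₀ 𝒜 ∉ 𝓑 →
      ∃ C ∈ 𝓑, {x | ∃ A ∈ 𝒜, A \ C = {x}} ∉ 𝓑 := by
  obtain ⟨-, hsub, hunion⟩ := hB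
  induction k with
  | zero =>
    intro 𝒜 B hBB hcard hU
    refine absurd (hsub B _ hBB (Set.sUnion_subset fun A hA => ?_)) hU
    obtain ⟨hfin, hc⟩ := hcard A hA
    exact Set.sdiff_eq_empty.1 ((Set.ncard_eq_zero hfin).1 (Nat.le_zero.1 hc))
  | succ k ih =>
    intro 𝒜 B hBB hcard hU
    have hdrop : ∀ A ∈ 𝒜, ∀ D : Set κ, ((A \ B) ∩ D).Nonempty →
        (A \ (B ∪ D)).Finite ∧ (A \ (B ∪ D)).ncard ≤ k := by
      rintro A hA D ⟨x, hx, hxD⟩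
      obtain ⟨hfin, hc⟩ := hcard A hA
      have hlt : A \ (B ∪ D) ⊂ A \ B :=
        ⟨Set.sdiff_subset_sdiff_right Set.subset_union_left, fun h => (h hx).2 (Or.inr hxD)⟩
      exact ⟨hfin.subset hlt.subset, by have := Set.ncard_lt_ncard hlt hfin; omega⟩
    obtain ⟨ℳ, hℳ, hdisj, hmeet⟩ := exists_pairwiseDisjoint_subfamily_inter_nonempty
      (fun A => A \ B) {A ∈ 𝒜 | (A \ B).Nonempty} fun A hA => hA.2
    by_cases hM : (⋃ A ∈ ℳ, A \ B) ∈ 𝓑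
    · refine ih 𝒜 (B ∪ ⋃ A ∈ ℳ, A \ B) (hunion _ _ hBB hM) (fun A hA => ?_) hU
      by_cases hne : (A \ B).Nonempty
      · obtain ⟨A', hA', x, hx, hx'⟩ := hmeet A ⟨hA, hne⟩
        exact hdrop A hA _ ⟨x, hx, Set.mem_biUnion hA' hx'⟩
      · have h0 : A \ (B ∪ ⋃ A ∈ ℳ, A \ B) = ∅ := Set.sdiff_eq_empty.2
          ((Set.sdiff_eq_empty.1 (Set.not_nonempty_iff_eq_empty.1 hne)).trans
            Set.subset_union_left)
        simp [h0]
    · choose! t ht using fun A (hA : A ∈ ℳ) => (hℳ hA).2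
      by_cases hT : t '' ℳ ∈ 𝓑
      · obtain ⟨C, hC, hC'⟩ := ih ℳ (B ∪ t '' ℳ) (hunion _ _ hBB hT)
          (fun A hA => hdrop A (hℳ hA).1 _ ⟨t A, ht A hA, Set.mem_image_of_mem t hA⟩)
          (fun h => hM (hsub _ _ h (Set.iUnion₂_subset fun A hA =>
            Set.sdiff_subset.trans (Set.subset_sUnion_of_mem hA))))
        exact ⟨C, hC, fun h => hC' (hsub _ _ h fun x ⟨A, hA, hx⟩ => ⟨A, (hℳ hA).1, hx⟩)⟩
      · refine ⟨B ∪ (t '' ℳ)ᶜ, hunion _ _ hBB ((hultra _).resolve_left hT),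
          fun h => hT (hsub _ _ h ?_)⟩
        rintro _ ⟨A, hA, rfl⟩
        refine ⟨A, (hℳ hA).1, Set.Subset.antisymm ?_ ?_⟩
        · rintro x ⟨hxA, hx⟩
          rw [Set.mem_union, not_or, Set.mem_compl_iff, not_not] at hx
          obtain ⟨hxB, A', hA', rfl⟩ := hx
          rw [Set.mem_singleton_iff,
            hdisj.elim_set hA' hA (t A') (ht A' hA') ⟨hxA, hxB⟩]
        · rintro _ rfl
          exact ⟨(ht A hA).1, fun h =>
            h.elim (ht A hA).2 fun h => h (Set.mem_image_of_mem t hA)⟩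

/-- **Theorem 4.4.** If `{κ \ B : B ∈ 𝓑}` is an ultrafilter on `κ` and `n ≥ 1`,
then the ballean `{0,1}^𝓑_n` is ultranormal: any two unbounded subsets of
`X_n` are linked. -/
theorem macrocube_Xn_ultranormal {κ : Type*} [Infinite κ]
    (𝓑 : Set (Set κ)) (hB : IsBornology 𝓑) (hunb : Set.univ ∉ 𝓑)
    (hultra : ∀ S : Set κ, S ∈ 𝓑 ∨ Sᶜ ∈ 𝓑) (n : ℕ) (hn : 1 ≤ n) :
    ∀ 𝒜₁ 𝒜₂ : Set (Set κ), 𝒜₁ ⊆ mcXn 𝓑 n → 𝒜₂ ⊆ mcXn 𝓑 n →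
      ¬ mcBounded 𝓑 𝒜₁ → ¬ mcBounded 𝓑 𝒜₂ →
        mcLinkedn 𝓑 n 𝒜₁ 𝒜₂ := by
  intro 𝒜₁ 𝒜₂ h₁ h₂ hu₁ hu₂
  have traces : ∀ 𝒜 ⊆ mcXn 𝓑 n, ¬ mcBounded 𝓑 𝒜 →
      ∃ C ∈ 𝓑, {x | ∃ A ∈ 𝒜, A \ C = {x}} ∉ 𝓑 := fun 𝒜 h hu =>
    hB.exists_unbounded_singleton_traces hultra n 𝒜 ∅ (hB.1 _ Set.finite_empty)
      (fun A hA => by simpa using (h hA).2)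
      (fun hU => hu ⟨⋃₀ 𝒜, hU, fun A hA A' hA' => Set.symmDiff_subset_union.trans
        (Set.union_subset (Set.subset_sUnion_of_mem hA) (Set.subset_sUnion_of_mem hA'))⟩)
  obtain ⟨C₁, hC₁, hL₁⟩ := traces 𝒜₁ h₁ hu₁
  obtain ⟨C₂, hC₂, hL₂⟩ := traces 𝒜₂ h₂ hu₂
  set L₁ := {x | ∃ A ∈ 𝒜₁, A \ C₁ = {x}}
  set L₂ := {x | ∃ A ∈ 𝒜₂, A \ C₂ = {x}}
  obtain ⟨hfin, hsub, hunion⟩ := hB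
  have hL : L₁ ∩ L₂ ∉ 𝓑 := fun h => hunb <| hsub _ _
    (hunion _ _ h (hunion _ _ ((hultra L₁).resolve_left hL₁) ((hultra L₂).resolve_left hL₂)))
    fun x _ => by
      simp only [Set.mem_union, Set.mem_inter_iff, Set.mem_compl_iff]
      tauto
  have hmem : ∀ (𝒜 : Set (Set κ)) (C : Set κ), C ⊆ C₁ ∪ C₂ → ∀ x, (∃ A ∈ 𝒜, A \ C = {x}) →
      {x} ∈ mcEn 𝓑 n (C₁ ∪ C₂) 𝒜 := by
    rintro 𝒜 C hC x ⟨A, hA, hx⟩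
    refine ⟨⟨hfin _ (Set.finite_singleton x), Set.finite_singleton x, by simpa using hn⟩,
      A, hA, ?_⟩
    rintro y (⟨hy, hyA⟩ | ⟨hyA, hy⟩)
    · exact absurd (hx.symm.subset hy).1 hyA
    · exact hC (by_contra fun hyC => hy (hx.subset ⟨hyA, hyC⟩))
  refine ⟨C₁ ∪ C₂, hunion _ _ hC₁ hC₂, ?_⟩
  rintro ⟨D, hD, hbound⟩
  have hmem' : ∀ x ∈ L₁ ∩ L₂, {x} ∈ mcEn 𝓑 n (C₁ ∪ C₂) 𝒜₁ ∩ mcEn 𝓑 n (C₁ ∪ C₂) 𝒜₂ :=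
    fun x hx => ⟨hmem _ C₁ Set.subset_union_left x hx.1, hmem _ C₂ Set.subset_union_right x hx.2⟩
  obtain ⟨x, hx⟩ : (L₁ ∩ L₂).Nonempty :=
    Set.nonempty_iff_ne_empty.2 fun h => hL (h ▸ hfin _ Set.finite_empty)
  refine hL (hsub _ _ (hunion _ _ hD (hfin _ (Set.finite_singleton x))) fun y hy => ?_)
  by_cases hyx : y = x
  · exact Or.inr hyx
  · exact Or.inl (hbound _ (hmem' y hy) _ (hmem' x hx) (Or.inl ⟨rfl, hyx⟩))
end

section
/- Let 𝓑 be an unbounded bornology on an infinite set κ such that the family {κ \ B : B ∈ 𝓑} is an ultrafilter on κ, and let n ≥ 1. Then every unbounded subset 𝒜 of X_n = {A ∈ 𝓑 : |A| ≤ n} is linked with X_1 = {A ∈ 𝓑 : |A| ≤ 1} in the ballean {0,1}^𝓑_n. -/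
open scoped symmDiff

/-- Every family of nonempty sets has a pairwise disjoint subfamily whose union meets each
member of the family. -/
theorem exists_pairwiseDisjoint_subfamily_meeting {κ : Type*} (𝒞 : Set (Set κ))
    (hne : ∀ C ∈ 𝒞, C.Nonempty) :
    ∃ 𝒟 ⊆ 𝒞, 𝒟.PairwiseDisjoint id ∧ ∀ C ∈ 𝒞, (C ∩ ⋃₀ 𝒟).Nonempty := by
  obtain ⟨𝒟, h𝒟⟩ := zorn_subset {𝒟 : Set (Set κ) | 𝒟 ⊆ 𝒞 ∧ 𝒟.PairwiseDisjoint id}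
    (fun c hc hchain => ⟨⋃₀ c, ⟨Set.sUnion_subset fun s hs => (hc hs).1,
      (Set.pairwiseDisjoint_sUnion hchain.directedOn).2 fun s hs => (hc hs).2⟩,
      fun s hs => Set.subset_sUnion_of_mem hs⟩)
  refine ⟨𝒟, h𝒟.prop.1, h𝒟.prop.2, fun C hC => ?_⟩
  by_contra hempty
  have hdisj : Disjoint C (⋃₀ 𝒟) :=
    Set.disjoint_iff_inter_eq_empty.2 (Set.not_nonempty_iff_eq_empty.1 hempty)
  have hmem : insert C 𝒟 ∈ {𝒟 : Set (Set κ) | 𝒟 ⊆ 𝒞 ∧ 𝒟.PairwiseDisjoint id} :=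
    ⟨Set.insert_subset hC h𝒟.prop.1, h𝒟.prop.2.insert fun D hD _ =>
      hdisj.mono_right (Set.subset_sUnion_of_mem hD)⟩
  have hC𝒟 : C ∈ 𝒟 := h𝒟.le_of_ge hmem (Set.subset_insert C 𝒟) (Set.mem_insert C 𝒟)
  obtain ⟨x, hx⟩ := hne C hC
  exact hempty ⟨x, hx, C, hC𝒟, hx⟩

/-- If the complements of members of a bornology form an ultrafilter, then a family of sets of
bounded finite cardinality with union outside the bornology becomes, after removing a suitable
member of the bornology, a family with many singletons. -/
theorem exists_mem_setOf_diff_eq_singleton_notMem {κ : Type*} {𝓑 : Set (Set κ)}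
    (hB : IsBornology 𝓑) (hultra : ∀ S : Set κ, S ∈ 𝓑 ∨ Sᶜ ∈ 𝓑) (m : ℕ) (𝒞 : Set (Set κ))
    (hcard : ∀ C ∈ 𝒞, C.Finite ∧ C.ncard ≤ m) (hunion : ⋃₀ 𝒞 ∉ 𝓑) :
    ∃ B ∈ 𝓑, {x | ∃ C ∈ 𝒞, C \ B = {x}} ∉ 𝓑 := by
  obtain ⟨hfin, hsub, hun⟩ := hB
  induction m generalizing 𝒞 with
  | zero =>
    refine absurd (hfin _ ?_) hunion
    have : ⋃₀ 𝒞 = ∅ := Set.sUnion_eq_empty.2 fun C hC =>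
      (Set.ncard_eq_zero (hcard C hC).1).1 (Nat.le_zero.1 (hcard C hC).2)
    simp [this]
  | succ m ih =>
    have meeting : ∀ 𝒟 ⊆ 𝒞, ⋃₀ 𝒟 ∉ 𝓑 → ∀ P ∈ 𝓑, (∀ D ∈ 𝒟, (D ∩ P).Nonempty) →
        ∃ B ∈ 𝓑, {x | ∃ C ∈ 𝒞, C \ B = {x}} ∉ 𝓑 := by
      intro 𝒟 h𝒟 h𝒟un P hP hmeet
      obtain ⟨B, hB, hS⟩ := ih ((· \ P) '' 𝒟) (by
        rintro _ ⟨D, hD, rfl⟩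
        obtain ⟨hDfin, hDcard⟩ := hcard D (h𝒟 hD)
        obtain ⟨x, hxD, hxP⟩ := hmeet D hD
        have hlt : (D \ P).ncard < D.ncard :=
          Set.ncard_lt_ncard ⟨Set.sdiff_subset, fun h => (h hxD).2 hxP⟩ hDfin
        exact ⟨hDfin.sdiff, by dsimp only; omega⟩) (by
        intro h
        refine h𝒟un (hsub _ _ (hun _ _ h hP) ?_)
        rintro x ⟨D, hD, hx⟩
        by_cases hxP : x ∈ P
        · exact Or.inr hxP
        · exact Or.inl ⟨D \ P, ⟨D, hD, rfl⟩, hx, hxP⟩)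
      refine ⟨P ∪ B, hun _ _ hP hB, fun h => hS (hsub _ _ h ?_)⟩
      rintro x ⟨_, ⟨D, hD, rfl⟩, hx⟩
      exact ⟨D, h𝒟 hD, by rw [← Set.sdiff_sdiff, hx]⟩
    set 𝒩 : Set (Set κ) := {C ∈ 𝒞 | C.Nonempty}
    have h𝒩un : ⋃₀ 𝒩 ∉ 𝓑 := fun h => hunion (hsub _ _ h (by
      rintro x ⟨C, hC, hx⟩
      exact ⟨C, ⟨hC, x, hx⟩, hx⟩))
    obtain ⟨𝒟, h𝒟, hdisj, hmeet⟩ :=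
      exists_pairwiseDisjoint_subfamily_meeting 𝒩 fun C hC => hC.2
    by_cases h𝒟un : ⋃₀ 𝒟 ∈ 𝓑
    · exact meeting 𝒩 (fun C hC => hC.1) h𝒩un _ h𝒟un hmeet
    have : Nonempty κ := by
      by_contra hκ
      rw [not_nonempty_iff] at hκ
      exact hunion (hfin _ (Set.toFinite _))
    choose! t ht using fun D (hD : D ∈ 𝒟) => (h𝒟 hD).2
    by_cases hT : t '' 𝒟 ∈ 𝓑
    · exact meeting 𝒟 (fun D hD => (h𝒟 hD).1) h𝒟un _ hT
        fun D hD => ⟨t D, ht D hD, D, hD, rfl⟩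
    · refine ⟨(t '' 𝒟)ᶜ, (hultra _).resolve_left hT, fun h => hT (hsub _ _ h ?_)⟩
      rintro _ ⟨D, hD, rfl⟩
      refine ⟨D, (h𝒟 hD).1, ?_⟩
      rw [Set.sdiff_compl]
      refine Set.Subset.antisymm ?_
        (Set.singleton_subset_iff.2 ⟨ht D hD, D, hD, rfl⟩)
      rintro _ ⟨hxD, D', hD', rfl⟩
      rw [hdisj.elim_set hD hD' (t D') hxD (ht D' hD')]
      rfl

/-- If `{κ \ B : B ∈ 𝓑}` is an ultrafilter on `κ` and `n ≥ 1`, then every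
unbounded subset of `X_n` is linked with `X_1` in the ballean `{0,1}^𝓑_n`. -/
theorem macrocube_Xn_unbounded_linked_X1 {κ : Type*} [Infinite κ]
    (𝓑 : Set (Set κ)) (hB : IsBornology 𝓑) (hunb : Set.univ ∉ 𝓑)
    (hultra : ∀ S : Set κ, S ∈ 𝓑 ∨ Sᶜ ∈ 𝓑) (n : ℕ) (hn : 1 ≤ n) :
    ∀ 𝒜 : Set (Set κ), 𝒜 ⊆ mcXn 𝓑 n → ¬ mcBounded 𝓑 𝒜 →
      mcLinkedn 𝓑 n 𝒜 (mcXn 𝓑 1) := by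
  intro 𝒜 h𝒜 hunbdd
  obtain ⟨B, hBB, hS⟩ := exists_mem_setOf_diff_eq_singleton_notMem hB hultra n 𝒜
    (fun A hA => (h𝒜 hA).2) (fun h => hunbdd ⟨_, h, fun A hA A' hA' =>
      Set.symmDiff_subset_union.trans (Set.union_subset
        (Set.subset_sUnion_of_mem hA) (Set.subset_sUnion_of_mem hA'))⟩)
  obtain ⟨hfin, hsub, hun⟩ := hB
  refine ⟨B, hBB, ?_⟩
  rintro ⟨B', hB', hbound⟩
  have hsingle : ∀ k, 1 ≤ k → ∀ x : κ, ({x} : Set κ) ∈ mcXn 𝓑 k := fun k hk x =>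
    ⟨hfin _ (Set.finite_singleton x), Set.finite_singleton x, by simpa using hk⟩
  have hmem : ∀ x ∈ {x | ∃ A ∈ 𝒜, A \ B = {x}},
      ({x} : Set κ) ∈ mcEn 𝓑 n B 𝒜 ∩ mcEn 𝓑 n B (mcXn 𝓑 1) := by
    rintro x ⟨A, hA, hx⟩
    refine ⟨⟨hsingle n hn x, A, hA, ?_⟩,
      ⟨hsingle n hn x, {x}, hsingle 1 le_rfl x, by simp⟩⟩
    rw [← hx]
    rintro y (⟨⟨hyA, -⟩, hyA'⟩ | ⟨hyA, hy⟩)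
    · exact absurd hyA hyA'
    · by_contra hyB
      exact hy ⟨hyA, hyB⟩
  obtain ⟨x₀, hx₀⟩ : {x | ∃ A ∈ 𝒜, A \ B = {x}}.Nonempty := by
    by_contra h
    exact hS (hfin _ (by simp [Set.not_nonempty_iff_eq_empty.1 h]))
  refine hS (hsub _ _ (hun _ _ hB' (hfin _ (Set.finite_singleton x₀))) fun x hx => ?_)
  by_cases hxx₀ : x = x₀
  · exact Or.inr hxx₀
  · exact Or.inl (hbound _ (hmem x hx) _ (hmem x₀ hx₀) (Or.inl ⟨rfl, hxx₀⟩))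
end

section
/- A connected ballean (X, 𝓔) is normal if and only if for any two disjoint, asymptotically disjoint subsets Y, Z of X there exists a slowly oscillating function f : X → [0,1] such that f is identically 0 on Y and identically 1 on Z. -/
/-- `𝓔` is a coarse structure on `X`: each entourage contains the diagonal,
and `𝓔` is closed under composition, inversion and taking sub-entourages
containing the diagonal. -/
def IsCoarseStructure {X : Type*} (𝓔 : Set (Set (X × X))) : Prop :=
  (∀ E ∈ 𝓔, ∀ x : X, (x, x) ∈ E) ∧
  (∀ E ∈ 𝓔, ∀ F ∈ 𝓔, {p : X × X | ∃ z : X, (p.1, z) ∈ E ∧ (z, p.2) ∈ F} ∈ 𝓔) ∧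
  (∀ E ∈ 𝓔, {p : X × X | (p.2, p.1) ∈ E} ∈ 𝓔) ∧
  (∀ E ∈ 𝓔, ∀ E' : Set (X × X), (∀ x : X, (x, x) ∈ E') → E' ⊆ E → E' ∈ 𝓔)

/-- The ballean `(X, 𝓔)` is connected. -/
def CoarseConnected {X : Type*} (𝓔 : Set (Set (X × X))) : Prop :=
  ∀ x y : X, ∃ E ∈ 𝓔, (x, y) ∈ E

/-- The ball `E[x]` of radius `E` centered at `x`. -/
def cBall {X : Type*} (E : Set (X × X)) (x : X) : Set X := {y | (x, y) ∈ E}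

/-- `E[Y] = ⋃_{y ∈ Y} E[y]`. -/
def cBallSet {X : Type*} (E : Set (X × X)) (Y : Set X) : Set X :=
  {z | ∃ y ∈ Y, (y, z) ∈ E}

/-- A subset of `X` is bounded if it is contained in some ball. -/
def cBounded {X : Type*} (𝓔 : Set (Set (X × X))) (Y : Set X) : Prop :=
  ∃ E ∈ 𝓔, ∃ x : X, Y ⊆ cBall E x

/-- `Y` and `Z` are asymptotically disjoint. -/
def cAsympDisjoint {X : Type*} (𝓔 : Set (Set (X × X))) (Y Z : Set X) : Prop :=
  ∀ E ∈ 𝓔, cBounded 𝓔 (cBallSet E Y ∩ cBallSet E Z)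

/-- `U` is an asymptotic neighbourhood of `Y`. -/
def cAsympNbhd {X : Type*} (𝓔 : Set (Set (X × X))) (Y U : Set X) : Prop :=
  ∀ E ∈ 𝓔, cBounded 𝓔 (cBallSet E Y \ U)

/-- The ballean `(X, 𝓔)` is normal. -/
def cNormal {X : Type*} (𝓔 : Set (Set (X × X))) : Prop :=
  ∀ Y Z : Set X, cAsympDisjoint 𝓔 Y Z →
    ∃ U V : Set X, cAsympNbhd 𝓔 Y U ∧ cAsympNbhd 𝓔 Z V ∧ Disjoint U V

/-- `f : X → ℝ` is slowly oscillating. -/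
def SlowlyOscillating {X : Type*} (𝓔 : Set (Set (X × X))) (f : X → ℝ) : Prop :=
  ∀ E ∈ 𝓔, ∀ ε : ℝ, 0 < ε → ∃ B : Set X, cBounded 𝓔 B ∧
    ∀ x ∉ B, ∀ y ∈ cBall E x, ∀ y' ∈ cBall E x, |f y - f y'| < ε

theorem cBounded.mono {X : Type*} {𝓔 : Set (Set (X × X))} {A B : Set X}
    (hB : cBounded 𝓔 B) (hAB : A ⊆ B) : cBounded 𝓔 A := by
  obtain ⟨E, hE, x, hx⟩ := hB
  exact ⟨E, hE, x, hAB.trans hx⟩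

theorem cBounded.cBallSet {X : Type*} {𝓔 : Set (Set (X × X))} (h𝓔 : IsCoarseStructure 𝓔)
    {E : Set (X × X)} (hE : E ∈ 𝓔) {A : Set X} (hA : cBounded 𝓔 A) :
    cBounded 𝓔 (cBallSet E A) := by
  obtain ⟨F, hF, x, hx⟩ := hA
  refine ⟨_, h𝓔.2.1 F hF E hE, x, ?_⟩
  rintro z ⟨y, hy, hyz⟩
  exact ⟨y, hx hy, hyz⟩

theorem cBounded.union {X : Type*} {𝓔 : Set (Set (X × X))} (h𝓔 : IsCoarseStructure 𝓔)
    (hconn : CoarseConnected 𝓔) {A B : Set X} (hA : cBounded 𝓔 A) (hB : cBounded 𝓔 B) :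
    cBounded 𝓔 (A ∪ B) := by
  obtain ⟨E, hE, x, hx⟩ := hA
  obtain ⟨F, hF, y, hy⟩ := hB
  obtain ⟨G, hG, hxy⟩ := hconn x y
  refine ⟨_, h𝓔.2.1 E hE _ (h𝓔.2.1 G hG F hF), x, Set.union_subset ?_ ?_⟩
  · exact fun z hz => ⟨z, hx hz, z, h𝓔.1 G hG z, h𝓔.1 F hF z⟩
  · exact fun z hz => ⟨x, h𝓔.1 E hE x, y, hxy, hy hz⟩

theorem cBounded.biUnion_lt {X : Type*} {𝓔 : Set (Set (X × X))} (h𝓔 : IsCoarseStructure 𝓔)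
    (hconn : CoarseConnected 𝓔) (h0 : cBounded 𝓔 (∅ : Set X)) {A : ℕ → Set X}
    (hA : ∀ k, cBounded 𝓔 (A k)) (n : ℕ) : cBounded 𝓔 {x | ∃ k < n, x ∈ A k} := by
  induction n with
  | zero => simpa using h0
  | succ n ih =>
    refine (ih.union h𝓔 hconn (hA n)).mono ?_
    rintro x ⟨k, hk, hx⟩
    rcases Nat.lt_succ_iff_lt_or_eq.mp hk with h | rfl
    · exact Or.inl ⟨k, h, hx⟩
    · exact Or.inr hx

theorem cBallSet_mono {X : Type*} (E : Set (X × X)) {A B : Set X} (h : A ⊆ B) :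
    cBallSet E A ⊆ cBallSet E B := by
  rintro z ⟨y, hy, hyz⟩
  exact ⟨y, h hy, hyz⟩

theorem cBallSet_union {X : Type*} (E : Set (X × X)) (A B : Set X) :
    cBallSet E (A ∪ B) = cBallSet E A ∪ cBallSet E B := by
  ext z
  simp only [cBallSet, Set.mem_union, Set.mem_ofPred_eq]
  grind

theorem cAsympDisjoint.symm {X : Type*} {𝓔 : Set (Set (X × X))} {A B : Set X}
    (h : cAsympDisjoint 𝓔 A B) : cAsympDisjoint 𝓔 B A := fun E hE => by
  rw [Set.inter_comm]
  exact h E hE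

theorem cAsympDisjoint.mono {X : Type*} {𝓔 : Set (Set (X × X))} {A B A' B' : Set X}
    (h : cAsympDisjoint 𝓔 A B) (hA : A' ⊆ A) (hB : B' ⊆ B) : cAsympDisjoint 𝓔 A' B' :=
  fun E hE => (h E hE).mono (Set.inter_subset_inter (cBallSet_mono E hA) (cBallSet_mono E hB))

theorem cAsympDisjoint.union_left {X : Type*} {𝓔 : Set (Set (X × X))}
    (h𝓔 : IsCoarseStructure 𝓔) (hconn : CoarseConnected 𝓔) {A A' B : Set X}
    (h : cAsympDisjoint 𝓔 A B) (h' : cAsympDisjoint 𝓔 A' B) : cAsympDisjoint 𝓔 (A ∪ A') B :=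
  fun E hE => by
    rw [cBallSet_union, Set.union_inter_distrib_right]
    exact (h E hE).union h𝓔 hconn (h' E hE)

theorem cAsympDisjoint_empty_right {X : Type*} {𝓔 : Set (Set (X × X))}
    (h0 : ∀ E ∈ 𝓔, cBounded 𝓔 (∅ : Set X)) (A : Set X) : cAsympDisjoint 𝓔 A ∅ :=
  fun E hE => (h0 E hE).mono (by rintro x ⟨-, y, hy, -⟩; exact hy)

theorem cAsympNbhd.cAsympDisjoint_compl {X : Type*} {𝓔 : Set (Set (X × X))}
    (h𝓔 : IsCoarseStructure 𝓔) {Y U : Set X} (h : cAsympNbhd 𝓔 Y U) :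
    cAsympDisjoint 𝓔 Y Uᶜ := fun E hE => by
  refine ((h _ (h𝓔.2.1 E hE _ (h𝓔.2.2.1 E hE))).cBallSet h𝓔 hE).mono ?_
  rintro x ⟨⟨y, hy, hyx⟩, a, ha, hax⟩
  exact ⟨a, ⟨⟨y, hy, x, hyx, hax⟩, ha⟩, hax⟩

/-- `B` contains `A` and the complement of `B` is asymptotically disjoint from `A`. -/
def cWellInside {X : Type*} (𝓔 : Set (Set (X × X))) (A B : Set X) : Prop :=
  A ⊆ B ∧ cAsympDisjoint 𝓔 A Bᶜ

theorem cNormal.exists_between {X : Type*} {𝓔 : Set (Set (X × X))} (h𝓔 : IsCoarseStructure 𝓔)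
    (hconn : CoarseConnected 𝓔) (hn : cNormal 𝓔) {A B : Set X} (h : cWellInside 𝓔 A B) :
    ∃ C, cWellInside 𝓔 A C ∧ cWellInside 𝓔 C B := by
  obtain ⟨U, V, hU, hV, hUV⟩ := hn _ _ h.2
  have hAU := hU.cAsympDisjoint_compl h𝓔
  have hUB : cAsympDisjoint 𝓔 U Bᶜ :=
    (hV.cAsympDisjoint_compl h𝓔).symm.mono hUV.subset_compl_right le_rfl
  refine ⟨U ∩ B ∪ A, ⟨Set.subset_union_right, ?_⟩,
    Set.union_subset Set.inter_subset_right h.1,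
    (hUB.mono Set.inter_subset_left le_rfl).union_left h𝓔 hconn h.2⟩
  refine (hAU.symm.union_left h𝓔 hconn h.2.symm).symm.mono le_rfl ?_
  rw [← Set.compl_inter]
  exact Set.compl_subset_compl.mpr Set.subset_union_left

/-- Repeated interpolation of a relation on sets; the set `U n k` carries the dyadic
index `k / 2 ^ n`. -/
theorem exists_dyadic_chain {X : Type*} {R : Set X → Set X → Prop}
    (hR : ∀ A B, R A B → ∃ C, R A C ∧ R C B) {A B : Set X} (hAB : R A B)
    (huniv : ∀ C, R C Set.univ) :
    ∃ U : ℕ → ℕ → Set X, (∀ n k, R (U n k) (U n (k + 1))) ∧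
      (∀ n k, U (n + 1) (2 * k) = U n k) ∧ U 0 0 = A ∧ U 0 1 = B := by
  choose! g hg using hR
  let U₀ : ℕ → Set X := fun k => if k = 0 then A else if k = 1 then B else Set.univ
  let U : ℕ → ℕ → Set X := fun n => Nat.rec U₀
    (fun _ V k => if k % 2 = 0 then V (k / 2) else g (V (k / 2)) (V (k / 2 + 1))) n
  have hU : ∀ n k, U (n + 1) k =
      if k % 2 = 0 then U n (k / 2) else g (U n (k / 2)) (U n (k / 2 + 1)) := fun _ _ => rfl
  refine ⟨U, fun n => ?_, fun n k => by simp [hU], rfl, rfl⟩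
  induction n with
  | zero =>
    rintro (_ | k)
    · exact hAB
    · simpa [U, U₀] using huniv _
  | succ n ih =>
    intro k
    obtain ⟨j, rfl | rfl⟩ := Nat.even_or_odd' k
    · have h1 : (2 * j + 1) / 2 = j := by omega
      have h2 : (2 * j + 1) % 2 = 1 := by omega
      simpa [hU, h1, h2] using (hg _ _ (ih j)).1
    · have h1 : (2 * j + 1) / 2 = j := by omega
      have h2 : (2 * j + 1) % 2 = 1 := by omega
      have h3 : (2 * j + 1 + 1) / 2 = j + 1 := by omega
      have h4 : (2 * j + 1 + 1) % 2 = 0 := by omega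
      simpa [hU, h1, h2, h3, h4] using (hg _ _ (ih j)).2

theorem dyadic_refine {X : Type*} {U : ℕ → ℕ → Set X} (hU : ∀ n k, U (n + 1) (2 * k) = U n k)
    (n k i : ℕ) : U (n + i) (2 ^ i * k) = U n k := by
  induction i with
  | zero => simp
  | succ i ih => rw [← add_assoc, pow_succ', mul_assoc, hU, ih]

theorem dyadic_subset {X : Type*} {U : ℕ → ℕ → Set X} (hU : ∀ n k, U (n + 1) (2 * k) = U n k)
    (hmono : ∀ n k, U n k ⊆ U n (k + 1)) {m n j k : ℕ}
    (h : (j : ℝ) / 2 ^ m ≤ (k : ℝ) / 2 ^ n) : U m j ⊆ U n k := by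
  rw [div_le_div_iff₀ (by positivity) (by positivity)] at h
  have h' : 2 ^ n * j ≤ 2 ^ m * k := by
    rw [mul_comm, mul_comm _ k]
    exact_mod_cast h
  rw [← dyadic_refine hU m j n, ← dyadic_refine hU n k m, add_comm n m]
  exact monotone_nat_of_le_succ (hmono (m + n)) h'

/-- The Urysohn function of a dyadic family of sets, truncated at `1`. -/
noncomputable def dyadicUrysohn {X : Type*} (U : ℕ → ℕ → Set X) (x : X) : ℝ :=
  sInf (insert 1 {r : ℝ | ∃ n k : ℕ, r = (k : ℝ) / 2 ^ n ∧ x ∈ U n k})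

theorem dyadicUrysohn_bddBelow {X : Type*} (U : ℕ → ℕ → Set X) (x : X) :
    0 ∈ lowerBounds (insert 1 {r : ℝ | ∃ n k : ℕ, r = (k : ℝ) / 2 ^ n ∧ x ∈ U n k}) := by
  rintro r (rfl | ⟨n, k, rfl, -⟩)
  · exact zero_le_one
  · positivity

theorem dyadicUrysohn_mem_Icc {X : Type*} (U : ℕ → ℕ → Set X) (x : X) :
    dyadicUrysohn U x ∈ Set.Icc (0 : ℝ) 1 :=
  ⟨le_csInf (Set.insert_nonempty _ _) (dyadicUrysohn_bddBelow U x),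
    csInf_le ⟨0, dyadicUrysohn_bddBelow U x⟩ (Set.mem_insert _ _)⟩

theorem dyadicUrysohn_le {X : Type*} {U : ℕ → ℕ → Set X} {x : X} {n k : ℕ} (h : x ∈ U n k) :
    dyadicUrysohn U x ≤ (k : ℝ) / 2 ^ n :=
  csInf_le ⟨0, dyadicUrysohn_bddBelow U x⟩ (Or.inr ⟨n, k, rfl, h⟩)

theorem mem_of_dyadicUrysohn_lt {X : Type*} {U : ℕ → ℕ → Set X}
    (hU : ∀ n k, U (n + 1) (2 * k) = U n k) (hmono : ∀ n k, U n k ⊆ U n (k + 1))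
    {x : X} {n k : ℕ} (hk : k ≤ 2 ^ n) (h : dyadicUrysohn U x < (k : ℝ) / 2 ^ n) :
    x ∈ U n k := by
  obtain ⟨r, hr, hrk⟩ := exists_lt_of_csInf_lt (Set.insert_nonempty _ _) h
  rcases hr with rfl | ⟨m, j, rfl, hx⟩
  · rw [lt_div_iff₀ (by positivity), one_mul] at hrk
    exact absurd (show 2 ^ n < k by exact_mod_cast hrk) (by omega)
  · exact dyadic_subset hU hmono hrk.le hx

theorem dyadicUrysohn_le_add {X : Type*} {U : ℕ → ℕ → Set X}
    (hU : ∀ n k, U (n + 1) (2 * k) = U n k) (hmono : ∀ n k, U n k ⊆ U n (k + 1))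
    {x y : X} {n : ℕ} (h : ∀ k < 2 ^ n + 1, x ∈ U n k → y ∈ U n (k + 1)) :
    dyadicUrysohn U y ≤ dyadicUrysohn U x + 2 / 2 ^ n := by
  have hpos : (0 : ℝ) < 2 ^ n := by positivity
  obtain ⟨hx0, hx1⟩ := dyadicUrysohn_mem_Icc U x
  have hy1 := (dyadicUrysohn_mem_Icc U y).2
  rcases hx1.eq_or_lt with hx | hx
  · have : (0 : ℝ) < 2 / 2 ^ n := by positivity
    linarith
  set t := dyadicUrysohn U x with ht
  set k := ⌊t * 2 ^ n⌋₊
  have hlt : t * 2 ^ n < (k : ℝ) + 1 := Nat.lt_floor_add_one _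
  have hle : (k : ℝ) ≤ t * 2 ^ n := Nat.floor_le (by positivity)
  have hk : k + 1 ≤ 2 ^ n := by
    have : (k : ℝ) < 2 ^ n := by nlinarith
    exact_mod_cast this
  have hxk : x ∈ U n (k + 1) := by
    refine mem_of_dyadicUrysohn_lt hU hmono hk ?_
    rw [lt_div_iff₀ hpos]
    push_cast
    exact hlt
  calc dyadicUrysohn U y ≤ ((k + 1 + 1 : ℕ) : ℝ) / 2 ^ n :=
        dyadicUrysohn_le (h _ (by omega) hxk)
    _ ≤ t + 2 / 2 ^ n := by
        rw [← sub_le_iff_le_add, ← sub_div, div_le_iff₀ hpos]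
        push_cast
        linarith

theorem slowlyOscillating_dyadicUrysohn {X : Type*} {𝓔 : Set (Set (X × X))}
    (h𝓔 : IsCoarseStructure 𝓔) (hconn : CoarseConnected 𝓔)
    (h0 : ∀ E ∈ 𝓔, cBounded 𝓔 (∅ : Set X)) {U : ℕ → ℕ → Set X}
    (hR : ∀ n k, cWellInside 𝓔 (U n k) (U n (k + 1)))
    (hU : ∀ n k, U (n + 1) (2 * k) = U n k) : SlowlyOscillating 𝓔 (dyadicUrysohn U) := by
  intro E hE ε hε
  obtain ⟨n, hn⟩ := exists_pow_lt_of_lt_one (show 0 < ε / 2 by positivity)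
    (show (1 / 2 : ℝ) < 1 by norm_num)
  have hn' : (2 : ℝ) / 2 ^ n < ε := by
    rw [one_div, inv_pow] at hn
    rw [div_eq_mul_inv]
    linarith
  refine ⟨_, cBounded.biUnion_lt h𝓔 hconn (h0 E hE)
    (fun k => (hR n k).2 _ (h𝓔.2.2.1 E hE)) (2 ^ n + 1), fun x hx => ?_⟩
  have key : ∀ y ∈ cBall E x, ∀ y' ∈ cBall E x,
      dyadicUrysohn U y' ≤ dyadicUrysohn U y + 2 / 2 ^ n := by
    refine fun y hy y' hy' => dyadicUrysohn_le_add hU (fun n k => (hR n k).1) fun k hk hyk => ?_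
    by_contra hyk'
    exact hx ⟨k, hk, ⟨y, hyk, hy⟩, y', hyk', hy'⟩
  intro y hy y' hy'
  rw [abs_sub_lt_iff]
  constructor
  · linarith [key y' hy' y hy]
  · linarith [key y hy y' hy']

theorem cNormal.exists_slowlyOscillating {X : Type*} {𝓔 : Set (Set (X × X))}
    (h𝓔 : IsCoarseStructure 𝓔) (hconn : CoarseConnected 𝓔) (hn : cNormal 𝓔) {Y Z : Set X}
    (hd : Disjoint Y Z) (hYZ : cAsympDisjoint 𝓔 Y Z) :
    ∃ f : X → ℝ, (∀ x : X, f x ∈ Set.Icc (0 : ℝ) 1) ∧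
      SlowlyOscillating 𝓔 f ∧ (∀ y ∈ Y, f y = 0) ∧ (∀ z ∈ Z, f z = 1) := by
  have h0 : ∀ E ∈ 𝓔, cBounded 𝓔 (∅ : Set X) := fun E hE =>
    (hYZ E hE).mono (Set.empty_subset _)
  obtain ⟨U, hR, hU, hU0, hU1⟩ := exists_dyadic_chain (R := cWellInside 𝓔) (A := Y) (B := Zᶜ)
    (fun A B h => hn.exists_between h𝓔 hconn h)
    ⟨hd.subset_compl_right, by rwa [compl_compl]⟩
    (fun C => ⟨Set.subset_univ C, by
      rw [Set.compl_univ]; exact cAsympDisjoint_empty_right h0 C⟩)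
  refine ⟨dyadicUrysohn U, dyadicUrysohn_mem_Icc U,
    slowlyOscillating_dyadicUrysohn h𝓔 hconn h0 hR hU, fun y hy => ?_, fun z hz => ?_⟩
  · refine le_antisymm ?_ (dyadicUrysohn_mem_Icc U y).1
    simpa using dyadicUrysohn_le (U := U) (n := 0) (k := 0) (hU0 ▸ hy)
  · refine le_antisymm (dyadicUrysohn_mem_Icc U z).2 (not_lt.mp fun hlt => ?_)
    have hz1 : z ∈ U 0 1 :=
      mem_of_dyadicUrysohn_lt hU (fun n k => (hR n k).1) (by norm_num) (by simpa using hlt)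
    rw [hU1] at hz1
    exact hz1 hz

theorem SlowlyOscillating.cBounded_far {X : Type*} {𝓔 : Set (Set (X × X))}
    (h𝓔 : IsCoarseStructure 𝓔) {f : X → ℝ} (hf : SlowlyOscillating 𝓔 f) {ε : ℝ} (hε : 0 < ε)
    {E : Set (X × X)} (hE : E ∈ 𝓔) :
    cBounded 𝓔 {x | ∃ y, (y, x) ∈ E ∧ ε ≤ |f y - f x|} := by
  obtain ⟨B, hB, h⟩ := hf _ (h𝓔.2.2.1 E hE) ε hε
  refine hB.mono ?_
  rintro x ⟨y, hyx, hxy⟩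
  by_contra hx
  exact (h x hx y hyx x (h𝓔.1 E hE x)).not_ge hxy

/-- **Theorem 1.2.** A connected ballean `(X, 𝓔)` is normal iff for any two
disjoint, asymptotically disjoint subsets `Y, Z` there is a slowly oscillating
function `f : X → [0,1]` with `f ≡ 0` on `Y` and `f ≡ 1` on `Z`. -/
theorem ballean_normal_iff_slowly_oscillating_urysohn {X : Type*}
    (𝓔 : Set (Set (X × X))) (hE : IsCoarseStructure 𝓔) (hconn : CoarseConnected 𝓔) :
    cNormal 𝓔 ↔
      ∀ Y Z : Set X, Disjoint Y Z → cAsympDisjoint 𝓔 Y Z →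
        ∃ f : X → ℝ, (∀ x : X, f x ∈ Set.Icc (0 : ℝ) 1) ∧
          SlowlyOscillating 𝓔 f ∧ (∀ y ∈ Y, f y = 0) ∧ (∀ z ∈ Z, f z = 1) := by
  refine ⟨fun hn Y Z hd hYZ => hn.exists_slowlyOscillating hE hconn hd hYZ, fun h Y Z hYZ => ?_⟩
  obtain ⟨f, -, hf, hf0, hf1⟩ :=
    h (Y \ Z) Z Set.disjoint_sdiff_left (hYZ.mono Set.sdiff_subset le_rfl)
  refine ⟨{x | f x < 1 / 2}, {x | 1 / 2 < f x}, fun E hEE => ?_, fun E hEE => ?_,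
    Set.disjoint_left.mpr fun x (hx : f x < 1 / 2) hx' => lt_asymm hx hx'⟩
  · have hinter : cBounded 𝓔 (Y ∩ Z) := (hYZ E hEE).mono fun x hx =>
      ⟨⟨x, hx.1, hE.1 E hEE x⟩, x, hx.2, hE.1 E hEE x⟩
    refine ((hf.cBounded_far hE one_half_pos hEE).union hE hconn
      (hinter.cBallSet hE hEE)).mono ?_
    rintro x ⟨⟨y, hy, hyx⟩, hx⟩
    by_cases hyZ : y ∈ Z
    · exact Or.inr ⟨y, ⟨hy, hyZ⟩, hyx⟩
    · refine Or.inl ⟨y, hyx, ?_⟩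
      rw [hf0 y ⟨hy, hyZ⟩, zero_sub, abs_neg]
      exact (not_lt.mp hx).trans (le_abs_self _)
  · refine (hf.cBounded_far hE one_half_pos hEE).mono ?_
    rintro x ⟨⟨z, hz, hzx⟩, hx⟩
    refine ⟨z, hzx, ?_⟩
    rw [hf1 z hz]
    have : f x ≤ 1 / 2 := not_lt.mp hx
    exact le_trans (by linarith) (le_abs_self _)
end

section
/- Let (X, 𝓔_X) and (Y, 𝓔_Y) be connected unbounded balleans (X is not bounded in (X, 𝓔_X) and Y is not bounded in (Y, 𝓔_Y)). If the product ballean X × Y is normal, then the bornology 𝓑_{X×Y} of bounded subsets of X × Y has a linearly ordered base, i.e., there is a chain (under inclusion) of bounded subsets of X × Y such that every bounded subset of X × Y is contained in some member of the chain. -/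
/-- Ball in the product ballean around a subset `S ⊆ X × Y`, for base
entourages `E ∈ 𝓔_X`, `F ∈ 𝓔_Y`. -/
def pBallSet {X Y : Type*} (E : Set (X × X)) (F : Set (Y × Y)) (S : Set (X × Y)) :
    Set (X × Y) :=
  {q | ∃ p ∈ S, (p.1, q.1) ∈ E ∧ (p.2, q.2) ∈ F}

/-- Boundedness in the product ballean `X × Y`. -/
def pBounded {X Y : Type*} (𝓔X : Set (Set (X × X))) (𝓔Y : Set (Set (Y × Y)))
    (S : Set (X × Y)) : Prop :=
  ∃ E ∈ 𝓔X, ∃ F ∈ 𝓔Y, ∃ p : X × Y,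
    S ⊆ {q | (p.1, q.1) ∈ E ∧ (p.2, q.2) ∈ F}

/-- Normality of the product ballean `X × Y`. -/
def pNormal {X Y : Type*} (𝓔X : Set (Set (X × X))) (𝓔Y : Set (Set (Y × Y))) : Prop :=
  ∀ S T : Set (X × Y),
    (∀ E ∈ 𝓔X, ∀ F ∈ 𝓔Y, pBounded 𝓔X 𝓔Y (pBallSet E F S ∩ pBallSet E F T)) →
    ∃ U V : Set (X × Y),
      (∀ E ∈ 𝓔X, ∀ F ∈ 𝓔Y, pBounded 𝓔X 𝓔Y (pBallSet E F S \ U)) ∧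
      (∀ E ∈ 𝓔X, ∀ F ∈ 𝓔Y, pBounded 𝓔X 𝓔Y (pBallSet E F T \ V)) ∧
      Disjoint U V

open Bornology Set

universe u v

/-- If bounded sets in `X` and `Y` satisfy the dichotomy `B ⊆ f C ∨ C ⊆ g B`, then `f` maps a
family with unbounded union to a cofinal family. -/
theorem exists_subset_of_not_isBounded_iUnion {X Y : Type*} [Bornology X] [Bornology Y]
    {f : Set Y → Set X} {g : Set X → Set Y}
    (hg : ∀ B, IsBounded B → IsBounded (g B))
    (h : ∀ B C, IsBounded B → IsBounded C → B ⊆ f C ∨ C ⊆ g B)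
    {o : Ordinal} {R : Ordinal → Set Y} (hR : ∀ i, IsBounded (R i))
    (hunb : ¬ IsBounded (⋃ i < o, R i)) {B : Set X} (hB : IsBounded B) :
    ∃ i < o, B ⊆ f (R i) := by
  by_contra! hcon
  refine hunb ((hg B hB).subset (iUnion₂_subset fun i hi => ?_))
  exact (h B (R i) hB (hR i)).resolve_left (hcon i hi)

theorem not_isBounded_iUnion_of_cofinal {X : Type*} [Bornology X]
    (hunb : ¬ IsBounded (univ : Set X)) {o : Ordinal} {R : Ordinal → Set X}
    (hR : ∀ B, IsBounded B → ∃ i < o, B ⊆ R i) : ¬ IsBounded (⋃ i < o, R i) := by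
  refine fun hb => hunb (hb.subset fun x _ => ?_)
  obtain ⟨i, hi, hx⟩ := hR {x} isBounded_singleton
  exact mem_iUnion₂.2 ⟨i, hi, hx rfl⟩

theorem exists_ordinal_not_isBounded_iUnion {X : Type u} {Y : Type v} [Bornology X] [Bornology Y]
    [Nonempty Y] (hunb : ¬ IsBounded (univ : Set X)) :
    ∃ o : Ordinal.{max u v}, ∃ (P : Ordinal.{max u v} → Set X) (Q : Ordinal.{max u v} → Set Y),
      (∀ i, IsBounded (P i)) ∧ (∀ i, IsBounded (Q i)) ∧
      ¬ (IsBounded (⋃ i < o, P i) ∧ IsBounded (⋃ i < o, Q i)) := by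
  let r : X × Y → X × Y → Prop := WellOrderingRel
  refine ⟨Ordinal.type r, fun i => {x | ∃ y, Ordinal.typein r (x, y) = i}, fun _ => ∅,
    fun i => ?_, fun _ => isBounded_empty, fun hb => hunb (hb.1.subset fun x _ => ?_)⟩
  · refine (Set.Subsingleton.finite ?_).isBounded
    rintro x ⟨y, hx⟩ x' ⟨y', hx'⟩
    exact congrArg Prod.fst (Ordinal.typein_injective r (hx.trans hx'.symm))
  · obtain ⟨y⟩ := ‹Nonempty Y›
    exact mem_iUnion₂.2 ⟨_, Ordinal.typein_lt_type r (x, y), y, rfl⟩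

/-- The dichotomy `B ⊆ f C ∨ C ⊆ g B` for bounded sets forces the product bornology to have a
linearly ordered base. -/
theorem exists_isChain_cofinal_isBounded {X : Type u} {Y : Type v} [Bornology X] [Bornology Y] [Nonempty Y]
    (hunbX : ¬ IsBounded (univ : Set X)) (hunbY : ¬ IsBounded (univ : Set Y))
    {f : Set Y → Set X} {g : Set X → Set Y}
    (hf : ∀ C, IsBounded C → IsBounded (f C)) (hg : ∀ B, IsBounded B → IsBounded (g B))
    (h : ∀ B C, IsBounded B → IsBounded C → B ⊆ f C ∨ C ⊆ g B) :
    ∃ 𝓒 : Set (Set (X × Y)), (∀ C ∈ 𝓒, IsBounded C) ∧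
      IsChain (· ⊆ ·) 𝓒 ∧ ∀ S : Set (X × Y), IsBounded S → ∃ C ∈ 𝓒, S ⊆ C := by
  have h' : ∀ C B, IsBounded C → IsBounded B → C ⊆ g B ∨ B ⊆ f C :=
    fun C B hC hB => (h B C hB hC).symm
  obtain ⟨o, ⟨P₀, Q₀, hP₀, hQ₀, hunb⟩, hmin⟩ :=
    exists_minimal_of_wellFoundedLT _ (exists_ordinal_not_isBounded_iUnion (Y := Y) hunbX)
  have hlt : ∀ i < o, ∀ (P : Ordinal.{max u v} → Set X) (Q : Ordinal.{max u v} → Set Y),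
      (∀ i, IsBounded (P i)) → (∀ i, IsBounded (Q i)) →
      IsBounded (⋃ j < i, P j) ∧ IsBounded (⋃ j < i, Q j) := by
    intro i hi P Q hP hQ
    by_contra hcon
    exact (hmin ⟨P, Q, hP, hQ, hcon⟩ hi.le).not_gt hi
  obtain ⟨P, Q, hP, hQ, hPc, hQc⟩ : ∃ (P : Ordinal.{max u v} → Set X) (Q : Ordinal.{max u v} → Set Y),
      (∀ i, IsBounded (P i)) ∧ (∀ i, IsBounded (Q i)) ∧
      (∀ B, IsBounded B → ∃ i < o, B ⊆ P i) ∧ (∀ C, IsBounded C → ∃ i < o, C ⊆ Q i) := by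
    by_cases hPb : IsBounded (⋃ i < o, P₀ i)
    · have hc : ∀ B, IsBounded B → ∃ i < o, B ⊆ f (Q₀ i) := fun B hB =>
        exists_subset_of_not_isBounded_iUnion hg h hQ₀ (fun hb => hunb ⟨hPb, hb⟩) hB
      exact ⟨fun i => f (Q₀ i), fun i => g (f (Q₀ i)), fun i => hf _ (hQ₀ i),
        fun i => hg _ (hf _ (hQ₀ i)), hc, fun C hC =>
          exists_subset_of_not_isBounded_iUnion hf h' (fun i => hf _ (hQ₀ i))
            (not_isBounded_iUnion_of_cofinal hunbX hc) hC⟩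
    · have hc : ∀ C, IsBounded C → ∃ i < o, C ⊆ g (P₀ i) := fun C hC =>
        exists_subset_of_not_isBounded_iUnion hf h' hP₀ hPb hC
      exact ⟨fun i => f (g (P₀ i)), fun i => g (P₀ i), fun i => hf _ (hg _ (hP₀ i)),
        fun i => hg _ (hP₀ i), fun B hB =>
          exists_subset_of_not_isBounded_iUnion hg h (fun i => hg _ (hP₀ i))
            (not_isBounded_iUnion_of_cofinal hunbY hc) hB, hc⟩
  let T : Ordinal → Set (X × Y) := fun i => (⋃ j ≤ i, P j) ×ˢ (⋃ j ≤ i, Q j)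
  have hT : Monotone T := fun i j hij => prod_mono
    (biUnion_mono (fun _ hk => le_trans hk hij) fun _ _ => le_rfl)
    (biUnion_mono (fun _ hk => le_trans hk hij) fun _ _ => le_rfl)
  refine ⟨T '' Iio o, ?_, ?_, fun S hS => ?_⟩
  · rintro _ ⟨i, hi, rfl⟩
    obtain ⟨h₁, h₂⟩ := hlt i hi P Q hP hQ
    refine IsBounded.prod ((h₁.union (hP i)).subset ?_) ((h₂.union (hQ i)).subset ?_) <;>
    · refine iUnion₂_subset fun j hj => ?_
      rcases hj.lt_or_eq with hlt' | rfl
      · exact fun x hx => Or.inl (mem_iUnion₂.2 ⟨j, hlt', hx⟩)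
      · exact subset_union_right
  · rintro _ ⟨i, -, rfl⟩ _ ⟨j, -, rfl⟩ -
    exact (le_total i j).imp (fun hij => hT hij) fun hij => hT hij
  · obtain ⟨hS₁, hS₂⟩ := isBounded_image_fst_and_snd.2 hS
    obtain ⟨i, hi, hiS⟩ := hPc _ hS₁
    obtain ⟨j, hj, hjS⟩ := hQc _ hS₂
    refine ⟨T (max i j), ⟨_, max_lt hi hj, rfl⟩, fun q hq => ⟨?_, ?_⟩⟩
    · exact mem_iUnion₂.2 ⟨i, le_max_left i j, hiS (mem_image_of_mem _ hq)⟩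
    · exact mem_iUnion₂.2 ⟨j, le_max_right i j, hjS (mem_image_of_mem _ hq)⟩

theorem IsCoarseStructure.cBounded_union {X : Type*} {𝓔 : Set (Set (X × X))}
    (hE : IsCoarseStructure 𝓔) (hconn : CoarseConnected 𝓔) {S T : Set X}
    (hS : cBounded 𝓔 S) (hT : cBounded 𝓔 T) : cBounded 𝓔 (S ∪ T) := by
  obtain ⟨E, hE₁, x, hS⟩ := hS
  obtain ⟨F, hF, y, hT⟩ := hT
  obtain ⟨G, hG, hxy⟩ := hconn x y
  refine ⟨_, hE.2.1 E hE₁ _ (hE.2.1 G hG F hF), x, union_subset (fun z hz => ?_) fun z hz => ?_⟩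
  · exact ⟨z, hS hz, z, hE.1 G hG z, hE.1 F hF z⟩
  · exact ⟨x, hE.1 E hE₁ x, y, hxy, hT hz⟩

theorem IsCoarseStructure.exists_subset_cBall {X : Type*} {𝓔 : Set (Set (X × X))}
    (hE : IsCoarseStructure 𝓔) (hconn : CoarseConnected 𝓔) {S : Set X}
    (hS : cBounded 𝓔 S) (x : X) : ∃ E ∈ 𝓔, S ⊆ cBall E x := by
  obtain ⟨E, hE₁, y, hS⟩ := hS
  obtain ⟨G, hG, hxy⟩ := hconn x y
  exact ⟨_, hE.2.1 G hG E hE₁, fun z hz => ⟨y, hxy, hS hz⟩⟩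

/-- The bornology of bounded subsets of a nonempty connected ballean. -/
abbrev IsCoarseStructure.bornology {X : Type*} [Nonempty X] {𝓔 : Set (Set (X × X))}
    (hE : IsCoarseStructure 𝓔) (hconn : CoarseConnected 𝓔) : Bornology X :=
  Bornology.ofBounded {S | cBounded 𝓔 S}
    (by
      obtain ⟨x⟩ := ‹Nonempty X›
      obtain ⟨E, hE₁, -⟩ := hconn x x
      exact ⟨E, hE₁, x, empty_subset _⟩)
    (fun _ ⟨E, hE₁, x, hS⟩ _ hT => ⟨E, hE₁, x, hT.trans hS⟩)
    (fun _ hS _ hT => hE.cBounded_union hconn hS hT)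
    (fun x => by
      obtain ⟨E, hE₁, hx⟩ := hconn x x
      exact ⟨E, hE₁, x, singleton_subset_iff.2 hx⟩)

theorem pBounded_iff_cBounded_image {X Y : Type*} {𝓔X : Set (Set (X × X))}
    {𝓔Y : Set (Set (Y × Y))} {S : Set (X × Y)} :
    pBounded 𝓔X 𝓔Y S ↔ cBounded 𝓔X (Prod.fst '' S) ∧ cBounded 𝓔Y (Prod.snd '' S) := by
  constructor
  · rintro ⟨E, hE, F, hF, p, hS⟩
    refine ⟨⟨E, hE, p.1, ?_⟩, ⟨F, hF, p.2, ?_⟩⟩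
    · rintro _ ⟨q, hq, rfl⟩
      exact (hS hq).1
    · rintro _ ⟨q, hq, rfl⟩
      exact (hS hq).2
  · rintro ⟨⟨E, hE, x, hx⟩, ⟨F, hF, y, hy⟩⟩
    exact ⟨E, hE, F, hF, (x, y), fun q hq =>
      ⟨hx (mem_image_of_mem _ hq), hy (mem_image_of_mem _ hq)⟩⟩

/-- **Theorem 1.3.** If the product of two connected unbounded balleans is
normal, then the bornology of bounded subsets of the product has a linearly
ordered base. -/
theorem product_normal_implies_linear_base {X Y : Type*}
    (𝓔X : Set (Set (X × X))) (𝓔Y : Set (Set (Y × Y)))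
    (hEX : IsCoarseStructure 𝓔X) (hEY : IsCoarseStructure 𝓔Y)
    (hconnX : CoarseConnected 𝓔X) (hconnY : CoarseConnected 𝓔Y)
    (hunbX : ¬ cBounded 𝓔X Set.univ) (hunbY : ¬ cBounded 𝓔Y Set.univ)
    (hnorm : pNormal 𝓔X 𝓔Y) :
    ∃ 𝓒 : Set (Set (X × Y)), (∀ C ∈ 𝓒, pBounded 𝓔X 𝓔Y C) ∧
      IsChain (· ⊆ ·) 𝓒 ∧ ∀ S : Set (X × Y), pBounded 𝓔X 𝓔Y S → ∃ C ∈ 𝓒, S ⊆ C := by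
  rcases isEmpty_or_nonempty (X × Y) with hempty | ⟨⟨x₀, y₀⟩⟩
  · exact ⟨∅, by simp, IsChain.empty, fun S ⟨_, _, _, _, p, _⟩ => isEmptyElim p⟩
  have : Nonempty X := ⟨x₀⟩
  have : Nonempty Y := ⟨y₀⟩
  let _ := hEX.bornology hconnX
  let _ := hEY.bornology hconnY
  have hbX : ∀ S : Set X, IsBounded S ↔ cBounded 𝓔X S := fun _ => isBounded_ofBounded_iff _
  have hbY : ∀ S : Set Y, IsBounded S ↔ cBounded 𝓔Y S := fun _ => isBounded_ofBounded_iff _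
  have hbXY : ∀ S : Set (X × Y), pBounded 𝓔X 𝓔Y S ↔ IsBounded S := fun S => by
    rw [pBounded_iff_cBounded_image, ← hbX, ← hbY, isBounded_image_fst_and_snd]
  obtain ⟨U, V, hU, hV, hUV⟩ := hnorm (univ ×ˢ {y₀}) ({x₀} ×ˢ univ) (by
    rintro E hE F hF
    refine ⟨E, hE, F, hF, (x₀, y₀), ?_⟩
    rintro q ⟨⟨p, ⟨-, rfl⟩, -, h₂⟩, ⟨p', ⟨rfl, -⟩, h₁, -⟩⟩
    exact ⟨h₁, h₂⟩)
  obtain ⟨E₀, hE₀, -⟩ := hconnX x₀ x₀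
  obtain ⟨F₀, hF₀, -⟩ := hconnY y₀ y₀
  simp only [hbXY] at hU hV ⊢
  refine exists_isChain_cofinal_isBounded (mt (hbX _).1 hunbX) (mt (hbY _).1 hunbY)
    (f := fun C => Prod.fst '' ((univ ×ˢ C) \ U)) (g := fun B => Prod.snd '' ((B ×ˢ univ) \ V))
    (fun C hC => ?_) (fun B hB => ?_) fun B C _ _ => ?_
  · obtain ⟨F, hF, hCF⟩ := hEY.exists_subset_cBall hconnY ((hbY C).1 hC) y₀
    refine (isBounded_image_fst_and_snd.2 ((hU E₀ hE₀ F hF).subset ?_)).1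
    exact sdiff_subset_sdiff_left fun q hq =>
      ⟨(q.1, y₀), ⟨mem_univ _, rfl⟩, hEX.1 E₀ hE₀ q.1, hCF hq.2⟩
  · obtain ⟨E, hE, hBE⟩ := hEX.exists_subset_cBall hconnX ((hbX B).1 hB) x₀
    refine (isBounded_image_fst_and_snd.2 ((hV E hE F₀ hF₀).subset ?_)).2
    exact sdiff_subset_sdiff_left fun q hq =>
      ⟨(x₀, q.2), ⟨rfl, mem_univ _⟩, hBE hq.1, hEY.1 F₀ hF₀ q.2⟩
  · by_contra! hcon
    obtain ⟨⟨b, hb, hbf⟩, ⟨c, hc, hcg⟩⟩ := hcon.imp not_subset.1 not_subset.1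
    refine hUV.notMem_of_mem_left (a := (b, c)) ?_ ?_
    · by_contra hbc
      exact hbf ⟨(b, c), ⟨⟨mem_univ _, hc⟩, hbc⟩, rfl⟩
    · by_contra hbc
      exact hcg ⟨(b, c), ⟨⟨hb, mem_univ _⟩, hbc⟩, rfl⟩
end
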